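/- Let a = (a_{ij}) be a k×k integer matrix with det a ≠ 0, and z, w ∈ ℂ^k. Let U ⊂ ℂ^k be a set of (det a)² points with ∑_i u_i a_{ij} − z_j ∈ Λ for each u ∈ U and j, whose images in (ℂ/Λ)^k are pairwise distinct, and let V ⊂ ℂ^k be a set of (det a)² points with ∑_j a_{ij} v_j − w_i ∈ Λ for each v ∈ V and i, whose images in (ℂ/Λ)^k are pairwise distinct; assume moreover v_j ∉ Λ for every v ∈ V and every j. For v ∈ V define C_i(v) ∈ ℤ by ∑_j a_{ij} v_j − w_i = C_i(v)τ + D_i(v) with C_i(v), D_i(v) ∈ ℤ, and set F_v(t) = det a · e^{−2πi ∑_i C_i(v) t_i} · ∏_j σ_{v_j}(∑_i t_i a_{ij} − z_j, τ). Then there exists a unique family of complex coefficients (c(u,v))_{u∈U, v∈V} such that for all u, u' ∈ U the function t ↦ (1/det a)·(∏_{j=1}^k ∑_{i=1}^k t_i a_{ij})·∑_{v∈V} c(u,v)·F_v(t + u'), defined for t near 0 with ∏_j(∑_i t_i a_{ij}) ≠ 0, extends to a function holomorphic in a neighborhood of 0 ∈ ℂ^k whose value at 0 equals 1 if u = u'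 and 0 otherwise. -/

import Mathlib

open Complex Filter
open scoped Topology

noncomputable section

/-- The lattice `Λ = ℤτ + ℤ ⊂ ℂ` as a set. -/
def Lam (τ : ℂ) : Set ℂ := {c | ∃ l m : ℤ, c = l * τ + m}

/-- The infinite product `(y;q) = ∏_{j=0}^∞ (1 - y qʲ)`. -/
def qPoch (y q : ℂ) : ℂ := ∏' j : ℕ, (1 - y * q ^ j)

/-- The first Jacobi theta function
`θ(z,τ) = i e^{πi(τ/4 - z)} (x;q)(q/x;q)(q;q)`, `q = e^{2πiτ}`, `x = e^{2πiz}`. -/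
def theta (z τ : ℂ) : ℂ :=
  Complex.I * Complex.exp ((Real.pi : ℂ) * Complex.I * (τ / 4 - z)) *
    qPoch (Complex.exp (2 * (Real.pi : ℂ) * Complex.I * z))
      (Complex.exp (2 * (Real.pi : ℂ) * Complex.I * τ)) *
    qPoch (Complex.exp (2 * (Real.pi : ℂ) * Complex.I * τ) /
        Complex.exp (2 * (Real.pi : ℂ) * Complex.I * z))
      (Complex.exp (2 * (Real.pi : ℂ) * Complex.I * τ)) *
    qPoch (Complex.exp (2 * (Real.pi : ℂ) * Complex.I * τ))
      (Complex.exp (2 * (Real.pi : ℂ) * Complex.I * τ))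

/-- `θ'(z,τ)`, the derivative of `θ` in the `z` variable. -/
def thetaD (z τ : ℂ) : ℂ := deriv (fun u => theta u τ) z

/-- `σ_w(t,τ) = θ(w-t,τ)θ'(0,τ)/(θ(w,τ)θ(t,τ))`. -/
def sigmaW (w t τ : ℂ) : ℂ := theta (w - t) τ * thetaD 0 τ / (theta w τ * theta t τ)

/-- The normalization property of the coefficient family `(c(u,v))`: for all `u, u' ∈ U`,
`(1/det a)(∏ⱼ ∑ᵢ tᵢaᵢⱼ)·∑_v c(u,v)F_v(t+u')` extends holomorphically near `0` with value
`δ_{u,u'}` at `0`. -/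
def CoeffProp (k n : ℕ) (a : Matrix (Fin k) (Fin k) ℤ)
    (u : Fin n → Fin k → ℂ) (F : Fin n → (Fin k → ℂ) → ℂ)
    (c : Fin n → Fin n → ℂ) : Prop :=
  ∀ p p' : Fin n, ∃ g : (Fin k → ℂ) → ℂ, ∃ s : Set (Fin k → ℂ),
    s ∈ nhds (0 : Fin k → ℂ) ∧ DifferentiableOn ℂ g s ∧
    g 0 = (if p = p' then (1 : ℂ) else 0) ∧
    ∀ t ∈ s, (∀ j : Fin k, (∑ i, t i * (a i j : ℂ)) ≠ 0) →
      g t = (1 / (a.det : ℂ)) * (∏ j, ∑ i, t i * (a i j : ℂ)) *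
        ∑ q, c p q * F q (fun i => t i + u p' i)

theorem summable_norm_mul_pow {q : ℂ} (hq : ‖q‖ < 1) (y : ℂ) :
    Summable fun j : ℕ => ‖-(y * q ^ j)‖ := by
  simpa using (summable_geometric_of_lt_one (norm_nonneg q) hq).mul_left ‖y‖

theorem multipliable_one_sub_mul_pow {q : ℂ} (hq : ‖q‖ < 1) (y : ℂ) :
    Multipliable fun j : ℕ => 1 - y * q ^ j := by
  simpa [sub_eq_add_neg] using multipliable_one_add_of_summable (summable_norm_mul_pow hq y)

theorem qPoch_eq_one_sub_mul {q : ℂ} (hq : ‖q‖ < 1) (y : ℂ) :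
    qPoch y q = (1 - y) * qPoch (y * q) q := by
  unfold qPoch
  have h := multipliable_one_sub_mul_pow hq (y * q)
  rw [tprod_eq_zero_mul']
  · simp [pow_succ', mul_assoc]
  · simpa [pow_succ', mul_assoc] using h

theorem qPoch_ne_zero {q y : ℂ} (hq : ‖q‖ < 1) (hy : ∀ j : ℕ, y * q ^ j ≠ 1) :
    qPoch y q ≠ 0 := by
  have := tprod_one_add_ne_zero_of_summable (f := fun j : ℕ => -(y * q ^ j))
    (fun j h => hy j (by linear_combination -h)) (summable_norm_mul_pow hq y)
  simpa [qPoch, sub_eq_add_neg] using this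

theorem differentiable_qPoch {q : ℂ} (hq : ‖q‖ < 1) : Differentiable ℂ fun y => qPoch y q := by
  have key : MultipliableLocallyUniformlyOn (fun (n : ℕ) y => 1 - y * q ^ n)
      (Set.univ : Set ℂ) := by
    use fun y => ∏' n : ℕ, (1 - y * q ^ n)
    simp_rw [sub_eq_add_neg]
    apply hasProdLocallyUniformlyOn_of_forall_compact isOpen_univ
    intro K _ hcK
    obtain ⟨R, hR⟩ := hcK.isBounded.exists_norm_le
    refine ((summable_geometric_of_lt_one (norm_nonneg q) hq).mul_left
      R).hasProdUniformlyOn_nat_one_add hcK (.of_forall fun n x hx => ?_) (fun _ => by fun_prop)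
    simpa using mul_le_mul_of_nonneg_right (hR x hx) (by positivity)
  rw [← differentiableOn_univ]
  exact key.hasProdLocallyUniformlyOn.differentiableOn
    (.of_forall fun _ => by simpa [Finset.prod_fn] using
      DifferentiableOn.finsetProd (fun _ _ => by fun_prop)) isOpen_univ

theorem norm_exp_two_pi_I_mul_lt_one {τ : ℂ} (hτ : 0 < τ.im) :
    ‖Complex.exp (2 * (Real.pi : ℂ) * Complex.I * τ)‖ < 1 := by
  simpa using UpperHalfPlane.norm_exp_two_pi_I_lt_one ⟨τ, hτ⟩

theorem exp_two_pi_I_mul_int (m : ℤ) : Complex.exp (2 * (Real.pi : ℂ) * Complex.I * m) = 1 :=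
  Complex.exp_eq_one_iff.2 ⟨m, by ring⟩

theorem exp_two_pi_I_mul_eq_one_iff {y : ℂ} :
    Complex.exp (2 * (Real.pi : ℂ) * Complex.I * y) = 1 ↔ ∃ m : ℤ, y = m := by
  rw [Complex.exp_eq_one_iff]
  refine exists_congr fun m => ⟨fun h => ?_, fun h => by rw [h]; ring⟩
  have h2 := Complex.two_pi_I_ne_zero
  exact mul_left_cancel₀ h2 (by rw [h]; ring)

theorem qPoch_exp_ne_zero {τ y : ℂ} (hτ : 0 < τ.im) (hy : ∀ (j : ℕ) (m : ℤ), y + j * τ ≠ m) :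
    qPoch (Complex.exp (2 * (Real.pi : ℂ) * Complex.I * y))
      (Complex.exp (2 * (Real.pi : ℂ) * Complex.I * τ)) ≠ 0 := by
  refine qPoch_ne_zero (norm_exp_two_pi_I_mul_lt_one hτ) fun j h => ?_
  rw [← Complex.exp_nat_mul, ← Complex.exp_add,
    show 2 * (Real.pi : ℂ) * Complex.I * y + j * (2 * (Real.pi : ℂ) * Complex.I * τ)
      = 2 * (Real.pi : ℂ) * Complex.I * (y + j * τ) by ring, exp_two_pi_I_mul_eq_one_iff] at h
  obtain ⟨m, hm⟩ := h
  exact hy j m hm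

theorem add_mul_ne_int {τ : ℂ} (hτ : 0 < τ.im) (j : ℕ) (m : ℤ) : τ + j * τ ≠ m := by
  intro h
  have := congrArg Complex.im h
  simp at this
  nlinarith [(Nat.cast_nonneg j : (0 : ℝ) ≤ j)]

theorem theta_ne_zero {τ w : ℂ} (hτ : 0 < τ.im) (hw : w ∉ Lam τ) : theta w τ ≠ 0 := by
  unfold theta
  rw [← Complex.exp_sub, ← mul_sub]
  refine mul_ne_zero (mul_ne_zero (mul_ne_zero (mul_ne_zero Complex.I_ne_zero
    (Complex.exp_ne_zero _)) (qPoch_exp_ne_zero hτ fun j m h => hw ⟨-j, m, ?_⟩))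
    (qPoch_exp_ne_zero hτ fun j m h => hw ⟨j + 1, -m, ?_⟩))
    (qPoch_exp_ne_zero hτ (add_mul_ne_int hτ))
  · push_cast; linear_combination h
  · push_cast; linear_combination -h

theorem differentiable_theta {τ : ℂ} (hτ : 0 < τ.im) : Differentiable ℂ fun z => theta z τ := by
  have h := differentiable_qPoch (norm_exp_two_pi_I_mul_lt_one hτ)
  unfold theta
  simp_rw [← Complex.exp_sub]
  have h1 : Differentiable ℂ fun z => qPoch (Complex.exp (2 * (Real.pi : ℂ) * Complex.I * z))
      (Complex.exp (2 * (Real.pi : ℂ) * Complex.I * τ)) := h.comp (by fun_prop)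
  have h2 : Differentiable ℂ fun z => qPoch (Complex.exp (2 * (Real.pi : ℂ) * Complex.I * τ -
      2 * (Real.pi : ℂ) * Complex.I * z)) (Complex.exp (2 * (Real.pi : ℂ) * Complex.I * τ)) :=
    h.comp (f := fun z => Complex.exp (2 * (Real.pi : ℂ) * Complex.I * τ -
      2 * (Real.pi : ℂ) * Complex.I * z)) (by fun_prop)
  fun_prop

theorem theta_zero {τ : ℂ} (hτ : 0 < τ.im) : theta 0 τ = 0 := by
  have := qPoch_eq_one_sub_mul (norm_exp_two_pi_I_mul_lt_one hτ) 1
  simp [theta, this]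

theorem theta_add_one (z τ : ℂ) : theta (z + 1) τ = -theta z τ := by
  have h1 : Complex.exp (2 * (Real.pi : ℂ) * Complex.I * (z + 1))
      = Complex.exp (2 * (Real.pi : ℂ) * Complex.I * z) := by
    rw [mul_add, mul_one, Complex.exp_add, Complex.exp_two_pi_mul_I, mul_one]
  have h2 : Complex.exp ((Real.pi : ℂ) * Complex.I * (τ / 4 - (z + 1)))
      = -Complex.exp ((Real.pi : ℂ) * Complex.I * (τ / 4 - z)) := by
    rw [show (Real.pi : ℂ) * Complex.I * (τ / 4 - (z + 1))
      = (Real.pi : ℂ) * Complex.I * (τ / 4 - z) - Real.pi * Complex.I by ring,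
      Complex.exp_sub, Complex.exp_pi_mul_I, div_neg, div_one]
  simp only [theta, h1, h2]
  ring

theorem theta_add_tau {τ : ℂ} (hτ : 0 < τ.im) (z : ℂ) :
    theta (z + τ) τ = -Complex.exp (-((Real.pi : ℂ) * Complex.I * (τ + 2 * z))) * theta z τ := by
  have hq := norm_exp_two_pi_I_mul_lt_one hτ
  have h1 : Complex.exp (2 * (Real.pi : ℂ) * Complex.I * (z + τ))
      = Complex.exp (2 * (Real.pi : ℂ) * Complex.I * z) *
        Complex.exp (2 * (Real.pi : ℂ) * Complex.I * τ) := by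
    rw [mul_add, Complex.exp_add]
  have h2 : Complex.exp ((Real.pi : ℂ) * Complex.I * (τ / 4 - (z + τ)))
      = Complex.exp ((Real.pi : ℂ) * Complex.I * (τ / 4 - z)) *
        (Complex.exp (-((Real.pi : ℂ) * Complex.I * (τ + 2 * z))) *
          Complex.exp (2 * (Real.pi : ℂ) * Complex.I * z)) := by
    rw [← Complex.exp_add, ← Complex.exp_add]
    ring_nf
  have hx := Complex.exp_ne_zero (2 * (Real.pi : ℂ) * Complex.I * z)
  have hq0 := Complex.exp_ne_zero (2 * (Real.pi : ℂ) * Complex.I * τ)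
  simp only [theta, h1, h2]
  generalize Complex.exp (2 * (Real.pi : ℂ) * Complex.I * z) = x at *
  generalize Complex.exp (2 * (Real.pi : ℂ) * Complex.I * τ) = q at *
  rw [qPoch_eq_one_sub_mul hq x, show q / (x * q) = x⁻¹ by field_simp,
    qPoch_eq_one_sub_mul hq x⁻¹, show q / x = x⁻¹ * q by field_simp]
  field_simp
  ring

theorem sigmaW_add_one (w t τ : ℂ) : sigmaW w (t + 1) τ = sigmaW w t τ := by
  have h := theta_add_one (w - (t + 1)) τ
  rw [show w - (t + 1) + 1 = w - t by ring] at h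
  rw [sigmaW, sigmaW, h, theta_add_one, mul_neg, neg_mul, div_neg, neg_div]

theorem sigmaW_add_tau {τ : ℂ} (hτ : 0 < τ.im) (w t : ℂ) :
    sigmaW w (t + τ) τ = Complex.exp (2 * (Real.pi : ℂ) * Complex.I * w) * sigmaW w t τ := by
  have h := theta_add_tau hτ (w - (t + τ))
  rw [show w - (t + τ) + τ = w - t by ring] at h
  rw [sigmaW, sigmaW, h, theta_add_tau hτ]
  have e : Complex.exp (2 * (Real.pi : ℂ) * Complex.I * w) *
      Complex.exp (-((Real.pi : ℂ) * Complex.I * (τ + 2 * (w - (t + τ))))) =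
      (Complex.exp (-((Real.pi : ℂ) * Complex.I * (τ + 2 * t))))⁻¹ := by
    rw [← Complex.exp_add, ← Complex.exp_neg]
    ring_nf
  simp only [div_eq_mul_inv, mul_inv, neg_mul, mul_neg, inv_neg, ← e]
  ring

theorem sigmaW_add_int_mul {τ : ℂ} (hτ : 0 < τ.im) (w t : ℂ) (l m : ℤ) :
    sigmaW w (t + (l * τ + m)) τ
      = Complex.exp (2 * (Real.pi : ℂ) * Complex.I * (w * l)) * sigmaW w t τ := by
  have h1 : ∀ (m : ℤ) (t : ℂ), sigmaW w (t + m) τ = sigmaW w t τ := by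
    intro m
    induction m with
    | zero => simp
    | succ n ih =>
      intro t
      rw [← ih t, ← sigmaW_add_one w (t + ((n : ℤ) : ℂ))]
      push_cast; ring_nf
    | pred n ih =>
      intro t
      rw [← ih t, ← sigmaW_add_one w (t + ((-n - 1 : ℤ) : ℂ))]
      push_cast; ring_nf
  have h2 : ∀ (l : ℤ) (t : ℂ), sigmaW w (t + l * τ) τ
      = Complex.exp (2 * (Real.pi : ℂ) * Complex.I * (w * l)) * sigmaW w t τ := by
    intro l
    induction l with
    | zero => simp
    | succ n ih =>
      intro t
      have := sigmaW_add_tau hτ w (t + n * τ)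
      rw [show t + ((n + 1 : ℤ) : ℂ) * τ = t + n * τ + τ by push_cast; ring, this]
      have := ih t
      push_cast at this
      rw [this, ← mul_assoc, ← Complex.exp_add]
      push_cast; ring_nf
    | pred n ih =>
      intro t
      have := sigmaW_add_tau hτ w (t + ((-n - 1 : ℤ) : ℂ) * τ)
      rw [show t + ((-n - 1 : ℤ) : ℂ) * τ + τ = t + (-n : ℤ) * τ by push_cast; ring, ih t] at this
      rw [← mul_right_inj' (Complex.exp_ne_zero (2 * (Real.pi : ℂ) * Complex.I * w)), ← this,
        ← mul_assoc (Complex.exp _), ← Complex.exp_add]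
      push_cast; ring_nf
  rw [← add_assoc, h1, h2]

theorem thetaD_zero_ne_zero {τ : ℂ} (hτ : 0 < τ.im) : thetaD 0 τ ≠ 0 := by
  have hq := norm_exp_two_pi_I_mul_lt_one hτ
  have h := differentiable_qPoch hq
  have h1 : Differentiable ℂ fun z => qPoch (Complex.exp (2 * (Real.pi : ℂ) * Complex.I * z) *
      Complex.exp (2 * (Real.pi : ℂ) * Complex.I * τ))
      (Complex.exp (2 * (Real.pi : ℂ) * Complex.I * τ)) :=
    h.comp (f := fun z => Complex.exp (2 * (Real.pi : ℂ) * Complex.I * z) *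
      Complex.exp (2 * (Real.pi : ℂ) * Complex.I * τ)) (by fun_prop)
  have h2 : Differentiable ℂ fun z => qPoch (Complex.exp (2 * (Real.pi : ℂ) * Complex.I * τ -
      2 * (Real.pi : ℂ) * Complex.I * z)) (Complex.exp (2 * (Real.pi : ℂ) * Complex.I * τ)) :=
    h.comp (f := fun z => Complex.exp (2 * (Real.pi : ℂ) * Complex.I * τ -
      2 * (Real.pi : ℂ) * Complex.I * z)) (by fun_prop)
  set B : ℂ → ℂ := fun z => Complex.I * Complex.exp ((Real.pi : ℂ) * Complex.I * (τ / 4 - z)) *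
    qPoch (Complex.exp (2 * (Real.pi : ℂ) * Complex.I * z) *
      Complex.exp (2 * (Real.pi : ℂ) * Complex.I * τ))
      (Complex.exp (2 * (Real.pi : ℂ) * Complex.I * τ)) *
    qPoch (Complex.exp (2 * (Real.pi : ℂ) * Complex.I * τ - 2 * (Real.pi : ℂ) * Complex.I * z))
      (Complex.exp (2 * (Real.pi : ℂ) * Complex.I * τ)) *
    qPoch (Complex.exp (2 * (Real.pi : ℂ) * Complex.I * τ))
      (Complex.exp (2 * (Real.pi : ℂ) * Complex.I * τ)) with hB
  have hθ : (fun z => theta z τ)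
      = fun z => (1 - Complex.exp (2 * (Real.pi : ℂ) * Complex.I * z)) * B z := by
    funext z
    rw [theta, qPoch_eq_one_sub_mul hq (Complex.exp (2 * (Real.pi : ℂ) * Complex.I * z)),
      ← Complex.exp_sub]
    simp only [hB]
    ring
  have hBd : Differentiable ℂ B := by fun_prop
  have hB0 : B 0 ≠ 0 := by
    have := qPoch_exp_ne_zero hτ (add_mul_ne_int hτ)
    simp [hB, this, Complex.I_ne_zero, Complex.exp_ne_zero]
  have hE : HasDerivAt (fun z : ℂ => 1 - Complex.exp (2 * (Real.pi : ℂ) * Complex.I * z))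
      (-(2 * (Real.pi : ℂ) * Complex.I)) 0 := by
    have := (((hasDerivAt_id (0 : ℂ)).const_mul (2 * (Real.pi : ℂ) * Complex.I)).cexp).const_sub 1
    simpa using this
  have := (hE.mul (hBd 0).hasDerivAt).deriv
  rw [Complex.exp_eq_one_iff.2 ⟨0, by simp⟩, sub_self, zero_mul, add_zero] at this
  rw [thetaD, hθ, show (fun z => (1 - Complex.exp (2 * (Real.pi : ℂ) * Complex.I * z)) * B z)
    = (fun z => 1 - Complex.exp (2 * (Real.pi : ℂ) * Complex.I * z)) * B from rfl, this]
  exact mul_ne_zero (neg_ne_zero.2 Complex.two_pi_I_ne_zero) hB0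

/-- The function `s ↦ s σ_w(s)` extends holomorphically across `0`, with value `1` there. -/
theorem exists_holomorphic_mul_sigmaW {τ w : ℂ} (hτ : 0 < τ.im) (hw : w ∉ Lam τ) :
    ∃ h : ℂ → ℂ, (∀ᶠ s in 𝓝 0, DifferentiableAt ℂ h s) ∧ h 0 = 1 ∧
      ∀ s, s ≠ 0 → h s = s * sigmaW w s τ := by
  set φ := dslope (fun z => theta z τ) 0 with hφ
  have hφd : Differentiable ℂ φ := by
    rw [← differentiableOn_univ, hφ, Complex.differentiableOn_dslope univ_mem]
    exact (differentiable_theta hτ).differentiableOn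
  have hφ0 : φ 0 = thetaD 0 τ := dslope_same _ _
  have hD := thetaD_zero_ne_zero hτ
  have hθw := theta_ne_zero hτ hw
  refine ⟨fun s => theta (w - s) τ * thetaD 0 τ / (theta w τ * φ s), ?_, ?_, ?_⟩
  · have : ∀ᶠ s in 𝓝 0, φ s ≠ 0 := hφd.continuous.continuousAt.eventually_ne (by rwa [hφ0])
    filter_upwards [this] with s hs
    have h1 : DifferentiableAt ℂ (fun s => theta (w - s) τ) s :=
      ((differentiable_theta hτ).comp (f := fun s => w - s) (by fun_prop)) s
    have h2 := hφd s
    exact (h1.mul_const _).div (h2.const_mul _) (mul_ne_zero hθw hs)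
  · simp only [sub_zero, hφ0]
    field_simp
  · intro s hs
    have : φ s = theta s τ / s := by
      rw [hφ, dslope_of_ne _ hs, slope_def_field, theta_zero hτ]
      simp
    simp only [this, sigmaW]
    field_simp

section Pairing

open Matrix

variable {k : ℕ}

theorem card_quotient_range_mulVecLin (A : Matrix (Fin k) (Fin k) ℤ) (hA : A.det ≠ 0) :
    Nat.card ((Fin k → ℤ) ⧸ LinearMap.range A.mulVecLin) = A.det.natAbs := by
  have hinj : Function.Injective A.mulVecLin := by
    rw [← LinearMap.ker_eq_bot, Matrix.ker_mulVecLin_eq_bot_iff]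
    exact fun v hv => Matrix.eq_zero_of_mulVec_eq_zero hA hv
  rw [← Submodule.natAbs_det_equiv _ (LinearEquiv.ofInjective A.mulVecLin hinj),
    ← LinearMap.det_toLin']
  rfl

/-- A family of `(det A)²` pairs of integer vectors that are pairwise incongruent modulo the image
of `A` represents every class of pairs. -/
theorem exists_eq_add_mulVec (A : Matrix (Fin k) (Fin k) ℤ) (hA : A.det ≠ 0)
    (l m : Fin (A.det.natAbs ^ 2) → Fin k → ℤ)
    (hlm : ∀ p q, (∃ r, l p - l q = A *ᵥ r) → (∃ s, m p - m q = A *ᵥ s) → p = q)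
    (x y : Fin k → ℤ) : ∃ p r s, x = l p + A *ᵥ r ∧ y = m p + A *ᵥ s := by
  set R := LinearMap.range A.mulVecLin
  have hc := card_quotient_range_mulVecLin A hA
  have : Finite ((Fin k → ℤ) ⧸ R) :=
    Nat.finite_of_card_ne_zero (by rw [hc]; exact Int.natAbs_ne_zero.2 hA)
  let φ : Fin (A.det.natAbs ^ 2) → ((Fin k → ℤ) ⧸ R) × ((Fin k → ℤ) ⧸ R) :=
    fun p => (R.mkQ (l p), R.mkQ (m p))
  have hφ : Function.Injective φ := by
    intro p q h
    obtain ⟨h1, h2⟩ := Prod.ext_iff.1 h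
    obtain ⟨r, hr⟩ := (Submodule.Quotient.eq R).1 h1
    obtain ⟨s, hs⟩ := (Submodule.Quotient.eq R).1 h2
    exact hlm p q ⟨r, hr.symm⟩ ⟨s, hs.symm⟩
  have hbij : Function.Bijective φ := by
    refine (Nat.bijective_iff_injective_and_card φ).2 ⟨hφ, ?_⟩
    rw [Nat.card_prod, hc, Nat.card_fin, sq]
  obtain ⟨p, hp⟩ := hbij.2 (R.mkQ x, R.mkQ y)
  obtain ⟨h1, h2⟩ := Prod.ext_iff.1 hp.symm
  obtain ⟨r, hr⟩ := (Submodule.Quotient.eq R).1 h1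
  obtain ⟨s, hs⟩ := (Submodule.Quotient.eq R).1 h2
  exact ⟨p, r, s, by rw [← sub_eq_iff_eq_add']; exact hr.symm,
    by rw [← sub_eq_iff_eq_add']; exact hs.symm⟩

/-- The character of `ℤᵏ × ℤᵏ` with frequency `(x, y)`. -/
def latticeChar (x y : Fin k → ℂ) : Multiplicative ((Fin k → ℤ) × (Fin k → ℤ)) →* ℂ where
  toFun g := Complex.exp (2 * (Real.pi : ℂ) * Complex.I *
    ((fun i => (g.toAdd.1 i : ℂ)) ⬝ᵥ x - (fun i => (g.toAdd.2 i : ℂ)) ⬝ᵥ y))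
  map_one' := by simp [dotProduct]
  map_mul' g h := by
    rw [← Complex.exp_add]
    simp only [dotProduct, toAdd_mul, Prod.fst_add, Prod.snd_add, Pi.add_apply, Int.cast_add,
      add_mul, Finset.sum_add_distrib]
    ring_nf

theorem latticeChar_ofAdd (x y : Fin k → ℂ) (l m : Fin k → ℤ) :
    latticeChar x y (Multiplicative.ofAdd (l, m)) = Complex.exp (2 * (Real.pi : ℂ) * Complex.I *
      ((fun i => (l i : ℂ)) ⬝ᵥ x - (fun i => (m i : ℂ)) ⬝ᵥ y)) := rfl

theorem exists_int_of_latticeChar_eq {x y x' y' : Fin k → ℂ}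
    (h : latticeChar x y = latticeChar x' y') (i : Fin k) :
    (∃ c : ℤ, x i - x' i = c) ∧ ∃ c : ℤ, y i - y' i = c := by
  have hs : (fun j => ((Pi.single i 1 : Fin k → ℤ) j : ℂ)) = Pi.single i 1 := by
    funext j
    by_cases hj : j = i
    · subst hj; simp
    · simp [hj]
  constructor
  · have := DFunLike.congr_fun h (Multiplicative.ofAdd (Pi.single i 1, 0))
    rw [latticeChar_ofAdd, latticeChar_ofAdd, hs, single_one_dotProduct,
      single_one_dotProduct] at this
    rw [← exp_two_pi_I_mul_eq_one_iff, mul_sub, Complex.exp_sub,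
      div_eq_one_iff_eq (Complex.exp_ne_zero _)]
    simpa [dotProduct] using this
  · have := DFunLike.congr_fun h (Multiplicative.ofAdd (0, Pi.single i 1))
    rw [latticeChar_ofAdd, latticeChar_ofAdd, hs, single_one_dotProduct,
      single_one_dotProduct] at this
    rw [← exp_two_pi_I_mul_eq_one_iff, mul_sub, Complex.exp_sub,
      div_eq_one_iff_eq (Complex.exp_ne_zero _)]
    simpa [dotProduct, Complex.exp_neg] using this

/-- The matrix of leading coefficients of the `F_v` at the points of `U` is invertible. -/
theorem isUnit_pairing (τ : ℂ) (a : Matrix (Fin k) (Fin k) ℤ) (ha : a.det ≠ 0) (z w : Fin k → ℂ)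
    (u : Fin (a.det.natAbs ^ 2) → Fin k → ℂ)
    (l m : Fin (a.det.natAbs ^ 2) → Fin k → ℤ)
    (hu : ∀ p j, (∑ i, u p i * (a i j : ℂ)) - z j = l p j * τ + m p j)
    (hudist : ∀ p q, (∀ i, u p i - u q i ∈ Lam τ) → p = q)
    (v : Fin (a.det.natAbs ^ 2) → Fin k → ℂ)
    (C D : Fin (a.det.natAbs ^ 2) → Fin k → ℤ)
    (hv : ∀ q i, (∑ j, (a i j : ℂ) * v q j) - w i = (C q i : ℂ) * τ + (D q i : ℂ))
    (hvdist : ∀ p q, (∀ j, v p j - v q j ∈ Lam τ) → p = q) :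
    IsUnit (Matrix.of fun q p => Complex.exp (2 * (Real.pi : ℂ) * Complex.I *
      (∑ j, v q j * l p j - ∑ i, (C q i : ℂ) * u p i))) := by
  set Z : Matrix (Fin k) (Fin k) ℂ := a.map (Int.cast : ℤ → ℂ) with hZ
  have hdet : IsUnit Z.det := by
    have : Z.det = (a.det : ℂ) := (Int.cast_det a).symm
    rw [this, isUnit_iff_ne_zero]
    exact_mod_cast ha
  let cst : (Fin k → ℤ) → Fin k → ℂ := fun f i => (f i : ℂ)
  have cst_add : ∀ f g, cst (f + g) = cst f + cst g := fun f g => by funext i; simp [cst]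
  have cst_sub : ∀ f g, cst (f - g) = cst f - cst g := fun f g => by funext i; simp [cst]
  have cst_mul : ∀ r, cst (aᵀ *ᵥ r) = cst r ᵥ* Z := fun r => by
    funext i
    simp [cst, hZ, mulVec, vecMul, dotProduct, mul_comm]
  have hu' : ∀ p, u p = (z + (τ • cst (l p) + cst (m p))) ᵥ* Z⁻¹ := fun p => by
    have : u p ᵥ* Z = z + (τ • cst (l p) + cst (m p)) := by
      funext j
      have := hu p j
      simp only [vecMul, dotProduct, hZ, Matrix.map_apply, Pi.add_apply, Pi.smul_apply, smul_eq_mul,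
        cst]
      linear_combination this
    rw [← this, vecMul_vecMul, Matrix.mul_nonsing_inv _ hdet, vecMul_one]
  have hv' : ∀ q, v q = Z⁻¹ *ᵥ (w + (τ • cst (C q) + cst (D q))) := fun q => by
    have : Z *ᵥ v q = w + (τ • cst (C q) + cst (D q)) := by
      funext j
      have := hv q j
      simp only [mulVec, dotProduct, hZ, Matrix.map_apply, Pi.add_apply, Pi.smul_apply, smul_eq_mul,
        cst]
      linear_combination this
    rw [← this, mulVec_mulVec, Matrix.nonsing_inv_mul _ hdet, one_mulVec]
  let χ : Fin (a.det.natAbs ^ 2) → Multiplicative ((Fin k → ℤ) × (Fin k → ℤ)) →* ℂ :=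
    fun q => latticeChar (Z⁻¹ *ᵥ cst (D q)) (Z⁻¹ *ᵥ cst (C q))
  have hχinj : Function.Injective χ := by
    intro q q' h
    refine hvdist q q' fun j => ?_
    obtain ⟨⟨d, hd⟩, c, hc⟩ := exists_int_of_latticeChar_eq h j
    refine ⟨c, d, ?_⟩
    rw [hv', hv', ← hc, ← hd]
    simp only [mulVec_add, mulVec_smul, Pi.add_apply, Pi.smul_apply, smul_eq_mul]
    ring
  have hind : LinearIndependent ℂ
      (fun q => (χ q : Multiplicative ((Fin k → ℤ) × (Fin k → ℤ)) → ℂ)) :=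
    (linearIndependent_monoidHom _ ℂ).comp χ hχinj
  have hrep := exists_eq_add_mulVec aᵀ (by rwa [det_transpose])
  rw [det_transpose] at hrep
  replace hrep := hrep l m (by
    rintro p q ⟨r, hr⟩ ⟨s, hs⟩
    refine hudist p q fun i => ⟨r i, s i, ?_⟩
    have : u p - u q = τ • cst r + cst s := by
      have e1 : u p - u q = (τ • cst (l p - l q) + cst (m p - m q)) ᵥ* Z⁻¹ := by
        rw [hu', hu', ← sub_vecMul, cst_sub, cst_sub]
        congr 1
        module
      rw [e1, hr, hs, cst_mul, cst_mul, ← smul_vecMul, ← add_vecMul, vecMul_vecMul,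
        Matrix.mul_nonsing_inv _ hdet, vecMul_one]
    have := congrFun this i
    simp only [Pi.sub_apply, Pi.add_apply, Pi.smul_apply, smul_eq_mul, cst] at this
    rw [this, mul_comm])
  have hχ : ∀ q p r s, χ q (Multiplicative.ofAdd (l p + aᵀ *ᵥ r, m p + aᵀ *ᵥ s))
      = χ q (Multiplicative.ofAdd (l p, m p)) := by
    intro q p r s
    have key : ∀ x y : Fin k → ℤ, ∃ n : ℤ, cst (aᵀ *ᵥ x) ⬝ᵥ Z⁻¹ *ᵥ cst y = n := fun x y => by
      refine ⟨x ⬝ᵥ y, ?_⟩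
      rw [cst_mul, dotProduct_mulVec, vecMul_vecMul, Matrix.mul_nonsing_inv _ hdet, vecMul_one]
      simp [dotProduct, cst]
    obtain ⟨n, hn⟩ := key r (D q)
    obtain ⟨n', hn'⟩ := key s (C q)
    simp only [χ, latticeChar_ofAdd]
    change Complex.exp (2 * (Real.pi : ℂ) * Complex.I *
      (cst (l p + aᵀ *ᵥ r) ⬝ᵥ _ - cst (m p + aᵀ *ᵥ s) ⬝ᵥ _)) =
      Complex.exp (2 * (Real.pi : ℂ) * Complex.I *
      (cst (l p) ⬝ᵥ _ - cst (m p) ⬝ᵥ _))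
    rw [cst_add, cst_add, add_dotProduct, add_dotProduct, hn, hn', ← mul_one (Complex.exp (_ *
      (cst (l p) ⬝ᵥ _ - cst (m p) ⬝ᵥ _))), ← exp_two_pi_I_mul_int (n - n'), ← Complex.exp_add]
    push_cast
    ring_nf
  let f : Fin (a.det.natAbs ^ 2) → ℂ := fun p => Complex.exp (2 * (Real.pi : ℂ) * Complex.I *
    (cst (l p) ⬝ᵥ Z⁻¹ *ᵥ w))
  let g : Fin (a.det.natAbs ^ 2) → ℂ := fun q => Complex.exp (2 * (Real.pi : ℂ) * Complex.I *
    -(z ⬝ᵥ Z⁻¹ *ᵥ cst (C q)))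
  have hN : ∀ q p, Complex.exp (2 * (Real.pi : ℂ) * Complex.I *
      (∑ j, v q j * l p j - ∑ i, (C q i : ℂ) * u p i))
      = f p * (g q * χ q (Multiplicative.ofAdd (l p, m p))) := by
    intro q p
    have e1 : ∑ j, v q j * l p j = cst (l p) ⬝ᵥ Z⁻¹ *ᵥ (w + (τ • cst (C q) + cst (D q))) := by
      rw [← hv', dotProduct_comm]; rfl
    have e2 : ∑ i, (C q i : ℂ) * u p i
        = (z + (τ • cst (l p) + cst (m p))) ⬝ᵥ Z⁻¹ *ᵥ cst (C q) := by
      rw [dotProduct_mulVec, ← hu', dotProduct_comm]; rfl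
    simp only [f, g, χ, latticeChar_ofAdd]
    change _ = _ * (_ * Complex.exp (_ * (cst (l p) ⬝ᵥ _ - cst (m p) ⬝ᵥ _)))
    rw [← Complex.exp_add, ← Complex.exp_add, e1, e2]
    simp only [mulVec_add, mulVec_smul, dotProduct_add, add_dotProduct, dotProduct_smul,
      smul_dotProduct, smul_eq_mul]
    ring_nf
  rw [← Matrix.linearIndependent_rows_iff_isUnit, Fintype.linearIndependent_iff]
  intro b hb q
  have hsum : ∑ q, (b q * g q) • (χ q : Multiplicative ((Fin k → ℤ) × (Fin k → ℤ)) → ℂ) = 0 := by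
    funext x
    obtain ⟨p, r, s, h1, h2⟩ := hrep x.toAdd.1 x.toAdd.2
    have hx : x = Multiplicative.ofAdd (l p + aᵀ *ᵥ r, m p + aᵀ *ᵥ s) := by
      rw [← h1, ← h2]; rfl
    have := congrFun hb p
    simp only [Finset.sum_apply, Pi.smul_apply, Matrix.row_apply, Matrix.of_apply, hN, smul_eq_mul,
      Pi.zero_apply] at this
    rw [hx]
    simp only [Finset.sum_apply, Pi.smul_apply, hχ, smul_eq_mul, Pi.zero_apply]
    refine (mul_eq_zero.1 (?_ : f p * _ = 0)).resolve_left (Complex.exp_ne_zero _)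
    rw [Finset.mul_sum, ← this]
    exact Finset.sum_congr rfl fun _ _ => by ring
  exact (mul_eq_zero.1 (Fintype.linearIndependent_iff.1 hind _ hsum q)).resolve_right
    (Complex.exp_ne_zero _)

end Pairing

/-- Two functions continuous at `0` that agree near `0` off the hyperplanes `∑ᵢ tᵢaᵢⱼ = 0` have the
same value at `0`. -/
theorem eq_at_zero_of_eq_off_hyperplanes {k : ℕ} (a : Matrix (Fin k) (Fin k) ℤ) (ha : a.det ≠ 0)
    {g h : (Fin k → ℂ) → ℂ} (hg : ContinuousAt g 0) (hh : ContinuousAt h 0)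
    (hgh : ∀ᶠ t in 𝓝 0, (∀ j : Fin k, (∑ i, t i * (a i j : ℂ)) ≠ 0) → g t = h t) :
    g 0 = h 0 := by
  set Z : Matrix (Fin k) (Fin k) ℂ := a.map (Int.cast : ℤ → ℂ) with hZ
  have hdet : IsUnit Z.det := by
    have : Z.det = (a.det : ℂ) := (Int.cast_det a).symm
    rw [this, isUnit_iff_ne_zero]
    exact_mod_cast ha
  set t₀ : Fin k → ℂ := Matrix.vecMul 1 Z⁻¹ with ht₀
  have hL : ∀ j, ∑ i, t₀ i * (a i j : ℂ) = 1 := by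
    intro j
    have : Matrix.vecMul t₀ Z = 1 := by
      rw [ht₀, Matrix.vecMul_vecMul, Matrix.nonsing_inv_mul _ hdet, Matrix.vecMul_one]
    simpa [Matrix.vecMul, dotProduct, hZ] using congrFun this j
  have hpath : Tendsto (fun s : ℂ => s • t₀) (𝓝[≠] 0) (𝓝 0) := by
    have : Continuous fun s : ℂ => s • t₀ := by fun_prop
    simpa using (this.tendsto 0).mono_left nhdsWithin_le_nhds
  have h1 : Tendsto (fun s : ℂ => g (s • t₀)) (𝓝[≠] 0) (𝓝 (g 0)) := hg.tendsto.comp hpath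
  have h2 : Tendsto (fun s : ℂ => h (s • t₀)) (𝓝[≠] 0) (𝓝 (h 0)) := hh.tendsto.comp hpath
  refine tendsto_nhds_unique h1 (h2.congr' ?_)
  filter_upwards [hpath.eventually hgh, self_mem_nhdsWithin] with s hs hs0
  refine (hs fun j => ?_).symm
  have : ∑ i, (s • t₀) i * (a i j : ℂ) = s := by
    simp only [Pi.smul_apply, smul_eq_mul, mul_assoc, ← Finset.mul_sum, hL, mul_one]
  rw [this]
  exact hs0

/-- Each `F_v`, multiplied by `∏ⱼ ∑ᵢ tᵢaᵢⱼ / det a`, extends holomorphically across a point of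
`U`. -/
theorem exists_extension_at_pole {τ : ℂ} (hτ : 0 < τ.im) {k : ℕ} (a : Matrix (Fin k) (Fin k) ℤ)
    (ha : a.det ≠ 0) (z u v : Fin k → ℂ) (l m C : Fin k → ℤ)
    (hu : ∀ j, (∑ i, u i * (a i j : ℂ)) - z j = l j * τ + m j) (hvL : ∀ j, v j ∉ Lam τ) :
    ∃ G : (Fin k → ℂ) → ℂ, (∀ᶠ t in 𝓝 0, DifferentiableAt ℂ G t) ∧
      G 0 = Complex.exp (2 * (Real.pi : ℂ) * Complex.I *
        (∑ j, v j * l j - ∑ i, (C i : ℂ) * u i)) ∧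
      ∀ t, (∀ j : Fin k, (∑ i, t i * (a i j : ℂ)) ≠ 0) →
        G t = (1 / (a.det : ℂ)) * (∏ j, ∑ i, t i * (a i j : ℂ)) *
          ((a.det : ℂ) * Complex.exp (-(2 * (Real.pi : ℂ) * Complex.I) *
            ∑ i, (C i : ℂ) * (t i + u i)) *
          ∏ j, sigmaW (v j) ((∑ i, (t i + u i) * (a i j : ℂ)) - z j) τ) := by
  choose h hd h0 hs using fun j => exists_holomorphic_mul_sigmaW hτ (hvL j)
  refine ⟨fun t => Complex.exp (-(2 * (Real.pi : ℂ) * Complex.I) * ∑ i, (C i : ℂ) * (t i + u i)) *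
    ∏ j, (Complex.exp (2 * (Real.pi : ℂ) * Complex.I * (v j * l j)) *
      h j (∑ i, t i * (a i j : ℂ))), ?_, ?_, ?_⟩
  · have hev : ∀ᶠ t : Fin k → ℂ in 𝓝 0, ∀ j, DifferentiableAt ℂ (h j) (∑ i, t i * (a i j : ℂ)) := by
      rw [eventually_all]
      intro j
      have : Continuous fun t : Fin k → ℂ => ∑ i, t i * (a i j : ℂ) := by fun_prop
      have h' := this.tendsto 0
      simp only [Pi.zero_apply, zero_mul, Finset.sum_const_zero] at h'
      exact h'.eventually (hd j)
    filter_upwards [hev] with t ht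
    have hj : ∀ j, DifferentiableAt ℂ (fun t : Fin k → ℂ =>
        Complex.exp (2 * (Real.pi : ℂ) * Complex.I * (v j * l j)) *
          h j (∑ i, t i * (a i j : ℂ))) t := fun j =>
      ((ht j).comp t (f := fun t : Fin k → ℂ => ∑ i, t i * (a i j : ℂ))
        (by fun_prop)).const_mul _
    exact DifferentiableAt.mul (by fun_prop)
      (HasFDerivAt.finsetProd fun j _ => (hj j).hasFDerivAt).differentiableAt
  · simp only [Pi.zero_apply, zero_mul, Finset.sum_const_zero, h0, mul_one, zero_add]
    rw [← Complex.exp_sum, ← Complex.exp_add, ← Finset.mul_sum]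
    ring_nf
  · intro t ht
    have e : ∀ j, (∑ i, (t i + u i) * (a i j : ℂ)) - z j
        = (∑ i, t i * (a i j : ℂ)) + (l j * τ + m j) := by
      intro j
      rw [← hu j]
      simp only [add_mul, Finset.sum_add_distrib]
      ring
    have hdet : (a.det : ℂ) ≠ 0 := by exact_mod_cast ha
    simp only [e, sigmaW_add_int_mul hτ, hs _ _ (ht _), Finset.prod_mul_distrib]
    field_simp

/-- Existence and uniqueness of the forms `ω_{u,H₁,…,H_k}`: there is a unique family of
coefficients `(c(u,v))` such that `ω_u := ∑_v c(u,v) F_v dt₁∧⋯∧dt_k` satisfies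
`ω_u(t+u') = (δ_{u,u'} + O(t)) d log(∑tᵢaᵢ₁)∧⋯∧d log(∑tᵢaᵢ_k)`. -/
theorem exists_unique_omega_u (τ : ℂ) (hτ : 0 < τ.im)
    (k : ℕ) (a : Matrix (Fin k) (Fin k) ℤ) (ha : a.det ≠ 0)
    (z w : Fin k → ℂ)
    (u : Fin (a.det.natAbs ^ 2) → Fin k → ℂ)
    (hu : ∀ p j, (∑ i, u p i * (a i j : ℂ)) - z j ∈ Lam τ)
    (hudist : ∀ p q, (∀ i, u p i - u q i ∈ Lam τ) → p = q)
    (v : Fin (a.det.natAbs ^ 2) → Fin k → ℂ)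
    (C D : Fin (a.det.natAbs ^ 2) → Fin k → ℤ)
    (hv : ∀ q i, (∑ j, (a i j : ℂ) * v q j) - w i = (C q i : ℂ) * τ + (D q i : ℂ))
    (hvdist : ∀ p q, (∀ j, v p j - v q j ∈ Lam τ) → p = q)
    (hvL : ∀ q j, v q j ∉ Lam τ)
    (F : Fin (a.det.natAbs ^ 2) → (Fin k → ℂ) → ℂ)
    (hF : ∀ q t, F q t =
      (a.det : ℂ) * Complex.exp (-(2 * (Real.pi : ℂ) * Complex.I) * ∑ i, (C q i : ℂ) * t i) *
        ∏ j, sigmaW (v q j) ((∑ i, t i * (a i j : ℂ)) - z j) τ) :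
    ∃! c : Fin (a.det.natAbs ^ 2) → Fin (a.det.natAbs ^ 2) → ℂ,
      CoeffProp k (a.det.natAbs ^ 2) a u F c := by
  choose l m hlm using hu
  have hN := isUnit_pairing τ a ha z w u l m hlm hudist v C D hv hvdist
  set N : Matrix (Fin (a.det.natAbs ^ 2)) (Fin (a.det.natAbs ^ 2)) ℂ :=
    Matrix.of fun q p => Complex.exp (2 * (Real.pi : ℂ) * Complex.I *
      (∑ j, v q j * l p j - ∑ i, (C q i : ℂ) * u p i)) with hNdef
  choose G hGd hG0 hG using fun q p =>
    exists_extension_at_pole hτ a ha z (u p) (v q) (l p) (m p) (C q) (hlm p) (hvL q)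
  have hSd : ∀ (c : Fin (a.det.natAbs ^ 2) → Fin (a.det.natAbs ^ 2) → ℂ) (p p'),
      ∀ᶠ t in 𝓝 0, DifferentiableAt ℂ (fun t => ∑ q, c p q * G q p' t) t := by
    intro c p p'
    filter_upwards [eventually_all.2 fun q => hGd q p'] with t ht
    exact DifferentiableAt.fun_sum fun q _ => (ht q).const_mul _
  have hS0 : ∀ (c : Fin (a.det.natAbs ^ 2) → Fin (a.det.natAbs ^ 2) → ℂ) (p p'),
      ∑ q, c p q * G q p' 0 = (Matrix.of c * N) p p' := by
    intro c p p'
    simp [Matrix.mul_apply, hNdef, hG0]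
  have hS : ∀ (c : Fin (a.det.natAbs ^ 2) → Fin (a.det.natAbs ^ 2) → ℂ) (p p')
      (t : Fin k → ℂ), (∀ j : Fin k, (∑ i, t i * (a i j : ℂ)) ≠ 0) →
      ∑ q, c p q * G q p' t = (1 / (a.det : ℂ)) * (∏ j, ∑ i, t i * (a i j : ℂ)) *
        ∑ q, c p q * F q (fun i => t i + u p' i) := by
    intro c p p' t ht
    rw [Finset.mul_sum]
    refine Finset.sum_congr rfl fun q _ => ?_
    rw [hG q p' t ht, hF]
    ring
  have hiff : ∀ c, CoeffProp k (a.det.natAbs ^ 2) a u F c ↔ Matrix.of c * N = 1 := by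
    intro c
    constructor
    · intro hc
      ext p p'
      obtain ⟨g, s, hs, hgd, hg0, hg⟩ := hc p p'
      rw [← hS0, Matrix.one_apply, ← hg0]
      refine eq_at_zero_of_eq_off_hyperplanes a ha
        (g := fun t => ∑ q, c p q * G q p' t) (h := g)
        (hSd c p p').self_of_nhds.continuousAt (hgd.differentiableAt hs).continuousAt ?_
      filter_upwards [hs] with t hts ht
      rw [hS c p p' t ht, hg t hts ht]
    · intro hc p p'
      refine ⟨fun t => ∑ q, c p q * G q p' t,
        {t | DifferentiableAt ℂ (fun t => ∑ q, c p q * G q p' t) t}, hSd c p p',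
        fun t ht => DifferentiableAt.differentiableWithinAt ht, ?_, fun t _ ht => hS c p p' t ht⟩
      exact (hS0 c p p').trans (by rw [hc, Matrix.one_apply])
  have hdet := (Matrix.isUnit_iff_isUnit_det N).1 hN
  refine ⟨Matrix.of.symm N⁻¹, (hiff _).2 (Matrix.nonsing_inv_mul N hdet), fun c hc => ?_⟩
  rw [Matrix.inv_eq_left_inv ((hiff c).1 hc), Equiv.symm_apply_apply]
end
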